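/- Top anonymity cannot be dropped from the characterization: there exists an SDR that satisfies top consistency (TC), top neutrality (TN), top monotonicity (TM) and top rationality (TR) but is not Condorcet-consistent; a witness is the serial dictatorship C₂(R) = B_n(R), where B_1(R) is the set of voter 1's most preferred alternatives in A and, for i ≥ 2, B_i(R) is the set of voter i's most preferred alternatives within B_{i-1}(R). -/

import Mathlib

/-- A weak order on `A`: a complete (total) and transitive binary relation. -/
structure WeakOrd (A : Type*) where
  rel : A → A → Prop
  total : ∀ x y, rel x y ∨ rel y x
  trans : ∀ x y z, rel x y → rel y z → rel x z

namespace WeakOrd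

variable {A : Type*}

/-- Strict preference. -/
def strict (r : WeakOrd A) (x y : A) : Prop := r.rel x y ∧ ¬ r.rel y x

/-- Indifference. -/
def indiff (r : WeakOrd A) (x y : A) : Prop := r.rel x y ∧ r.rel y x

open Classical in
/-- The weak order obtained from `r` by moving `x` and `y` strictly above all other
alternatives, preserving the relative ranking of `x` and `y` and of the rest. -/
noncomputable def topShift (r : WeakOrd A) (x y : A) : WeakOrd A where
  rel a b :=
    if a = x ∨ a = y then (if b = x ∨ b = y then r.rel a b else True)
    else if b = x ∨ b = y then False else r.rel a b
  total := by
    intro a b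
    by_cases ha : a = x ∨ a = y <;> by_cases hb : b = x ∨ b = y <;>
      simp [ha, hb, r.total a b]
  trans := by
    intro a b c hab hbc
    by_cases ha : a = x ∨ a = y <;> by_cases hb : b = x ∨ b = y <;>
      by_cases hc : c = x ∨ c = y <;> simp_all <;>
      exact r.trans _ _ _ hab hbc

/-- Relabelling the alternatives of a weak order by a permutation `σ`:
`a` is weakly preferred to `b` in `σ(r)` iff `σ⁻¹ a` is weakly preferred to `σ⁻¹ b` in `r`. -/
def map (σ : Equiv.Perm A) (r : WeakOrd A) : WeakOrd A where
  rel a b := r.rel (σ.symm a) (σ.symm b)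
  total := fun _ _ => r.total _ _
  trans := fun _ _ _ hab hbc => r.trans _ _ _ hab hbc

end WeakOrd

/-- A (preference) profile: a weak order for each voter. -/
abbrev Profile (N A : Type*) := N → WeakOrd A

namespace Profile

variable {N A : Type*}

/-- The top-shift profile `R^{x,y}`. -/
noncomputable def topShift (R : Profile N A) (x y : A) : Profile N A :=
  fun i => (R i).topShift x y

/-- Relabelling alternatives in every voter's preference by a permutation `σ`. -/
def map (σ : Equiv.Perm A) (R : Profile N A) : Profile N A := fun i => (R i).map σ

end Profile

/-- `nwins R x y` is `n(x,y,R)`, the number of voters strictly preferring `x` to `y`. -/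
noncomputable def nwins {N A : Type*} (R : Profile N A) (x y : A) : ℕ :=
  Nat.card {i // (R i).strict x y}

/-- The set of Condorcet winners of `R`. -/
def CW {N A : Type*} (R : Profile N A) : Set A :=
  {x | ∀ y, y ≠ x → nwins R y x ≤ nwins R x y}

/-- Condorcet consistency of a social decision rule. -/
def CondorcetConsistent {N A : Type*} (C : Profile N A → Set A) : Prop :=
  ∀ R : Profile N A, (CW R).Nonempty → C R = CW R

/-- The nice set `N_C(R)`: alternatives selected each time they are top-shifted with any
other alternative. -/
def niceSet {N A : Type*} (C : Profile N A → Set A) (R : Profile N A) : Set A :=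
  {x | ∀ y, y ≠ x → x ∈ C (R.topShift x y)}

/-- Weak top consistency (WTC). -/
def WeakTopConsistency {N A : Type*} (C : Profile N A → Set A) : Prop :=
  ∀ R : Profile N A, niceSet C R ⊆ C R

/-- Top consistency (TC). -/
def TopConsistency {N A : Type*} (C : Profile N A → Set A) : Prop :=
  ∀ R : Profile N A, (niceSet C R).Nonempty → C R = niceSet C R

/-- A 2-profile: two alternatives are unanimously strictly preferred to all others. -/
def IsTwoProfile {N A : Type*} (R : Profile N A) : Prop :=
  ∃ x y : A, x ≠ y ∧
    ∀ z, z ≠ x → z ≠ y → ∀ i, (R i).strict x z ∧ (R i).strict y z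

/-- Top anonymity (TA). -/
def TopAnonymity {N A : Type*} (C : Profile N A → Set A) : Prop :=
  ∀ R : Profile N A, IsTwoProfile R → ∀ π : Equiv.Perm N, C (fun i => R (π i)) = C R

/-- Top neutrality (TN). -/
def TopNeutrality {N A : Type*} (C : Profile N A → Set A) : Prop :=
  ∀ R : Profile N A, IsTwoProfile R → ∀ σ : Equiv.Perm A, C (Profile.map σ R) = σ '' (C R)

/-- Top symmetry (TS): top anonymity and top neutrality. -/
def TopSymmetry {N A : Type*} (C : Profile N A → Set A) : Prop :=
  TopAnonymity C ∧ TopNeutrality C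

/-- `Improves R Q x z`, i.e. `R ▷^{x,z} Q`: `Q` is an additional support of `x`
against `z` from `R` to `Q`. -/
def Improves {N A : Type*} (R Q : Profile N A) (x z : A) : Prop :=
  (∀ i w, ((R i).strict x w → (Q i).strict x w) ∧ ((R i).indiff x w → (Q i).rel x w)) ∧
  ∃ i, (R i).rel z x ∧ (Q i).strict x z

/-- Top monotonicity (TM). -/
def TopMonotonicity {N A : Type*} (C : Profile N A → Set A) : Prop :=
  ∀ (R Q : Profile N A) (x y z : A), x ≠ y → z ≠ x →
    x ∈ C (R.topShift x y) → Improves R Q x z →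
    x ∈ C (Q.topShift x y) ∧ z ∉ C (Q.topShift x y)

/-- Top rationality (TR). -/
def TopRationality {N A : Type*} (C : Profile N A → Set A) : Prop :=
  ∀ (R : Profile N A) (x y : A), x ≠ y → (C (R.topShift x y) ∩ {x, y}).Nonempty

/-- Maskin monotonicity (MM). -/
def MaskinMonotonic {N A : Type*} (C : Profile N A → Set A) : Prop :=
  ∀ (R Q : Profile N A) (x : A), x ∈ C R →
    (∀ i y, ((R i).strict x y → (Q i).strict x y) ∧ ((R i).indiff x y → (Q i).rel x y)) →
    x ∈ C Q

/-- The set of most preferred alternatives of `r` within `X`. -/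
def topOn {A : Type*} (r : WeakOrd A) (X : Set A) : Set A :=
  {x ∈ X | ∀ y ∈ X, r.rel x y}

/-- The serial-dictatorship sets: `B_0 = A` and `B_{i+1}` is the set of voter
`i+1`'s most preferred alternatives within `B_i`. -/
def Bseq {n : ℕ} {A : Type*} (R : Profile (Fin n) A) : ℕ → Set A
  | 0 => Set.univ
  | i + 1 => if h : i < n then topOn (R ⟨i, h⟩) (Bseq R i) else Bseq R i

/-- The serial dictatorship `C₂(R) = B_n(R)`. -/
def C2 {n : ℕ} {A : Type*} (R : Profile (Fin n) A) : Set A := Bseq R n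

namespace WeakOrd

variable {A : Type*}

theorem refl (r : WeakOrd A) (x : A) : r.rel x x := (r.total x x).elim id id

theorem rel_of_not_strict {r : WeakOrd A} {x y : A} (h : ¬ r.strict x y) : r.rel y x := by
  by_contra h'
  exact h ⟨(r.total x y).resolve_right h', h'⟩

theorem strict.asymm {r : WeakOrd A} {x y : A} (h : r.strict x y) : ¬ r.strict y x :=
  fun h' => h.2 h'.1

theorem topShift_comm (r : WeakOrd A) (x y : A) : r.topShift x y = r.topShift y x := by
  unfold topShift
  congr 1
  ext a b
  grind

theorem topShift_strict_iff (r : WeakOrd A) (x y : A) :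
    (r.topShift x y).strict x y ↔ r.strict x y := by
  simp [strict, topShift]

theorem topShift_strict_iff' (r : WeakOrd A) (x y : A) :
    (r.topShift x y).strict y x ↔ r.strict y x := by
  simp [strict, topShift]

theorem topShift_strict_of_ne (r : WeakOrd A) {x y z : A} (hx : z ≠ x) (hy : z ≠ y) :
    (r.topShift x y).strict x z := by
  simp [strict, topShift, hx, hy]

/-- The weak order induced by a utility function. -/
def ofUtility (u : A → ℕ) : WeakOrd A where
  rel x y := u y ≤ u x
  total x y := le_total (u y) (u x)
  trans _ _ _ hxy hyz := hyz.trans hxy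

theorem ofUtility_strict (u : A → ℕ) (x y : A) : (ofUtility u).strict x y ↔ u y < u x := by
  simp only [strict, ofUtility, not_le]
  omega

end WeakOrd

theorem topOn_nonempty {A : Type*} [Finite A] (r : WeakOrd A) {X : Set A} (hX : X.Nonempty) :
    (topOn r X).Nonempty := by
  have : IsTrans A r.strict :=
    ⟨fun _ _ _ h h' => ⟨r.trans _ _ _ h.1 h'.1, fun hc => h.2 (r.trans _ _ _ h'.1 hc)⟩⟩
  have : Std.Irrefl r.strict := ⟨fun _ h => h.2 h.1⟩
  obtain ⟨x, hx, hmax⟩ := (Finite.wellFounded_of_trans_of_irrefl r.strict).has_min X hX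
  exact ⟨x, hx, fun y hy => WeakOrd.rel_of_not_strict (hmax y hy)⟩

section SerialDictatorship

variable {A : Type*} {n : ℕ}

/-- Lexicographic weak preference: every voter strictly preferring `y` to `x` comes after
some voter strictly preferring `x` to `y`. -/
def LexPref (R : Profile (Fin n) A) (x y : A) : Prop :=
  ∀ i, (R i).strict y x → ∃ j < i, (R j).strict x y

theorem LexPref.refl (R : Profile (Fin n) A) (x : A) : LexPref R x x :=
  fun _ h => absurd h.1 h.2

theorem LexPref.total (R : Profile (Fin n) A) (x y : A) : LexPref R x y ∨ LexPref R y x := by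
  by_contra! h
  simp only [LexPref, not_forall, not_exists, not_and] at h
  obtain ⟨⟨i, hi, hi'⟩, j, hj, hj'⟩ := h
  rcases lt_trichotomy i j with h | h | h
  · exact hj' i h hi
  · exact (h ▸ hi).asymm hj
  · exact hi' j h hj

theorem Bseq_succ (R : Profile (Fin n) A) {k : ℕ} (hk : k < n) :
    Bseq R (k + 1) = topOn (R ⟨k, hk⟩) (Bseq R k) := by
  simp [Bseq, hk]

theorem Bseq_antitone (R : Profile (Fin n) A) : Antitone (Bseq R) := by
  refine antitone_nat_of_succ_le fun k => ?_
  by_cases hk : k < n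
  · rw [Bseq_succ R hk]
    exact fun _ h => h.1
  · simp [Bseq, hk]

theorem Bseq_nonempty [Finite A] [Nonempty A] (R : Profile (Fin n) A) (k : ℕ) :
    (Bseq R k).Nonempty := by
  induction k with
  | zero => exact Set.univ_nonempty
  | succ k ih =>
    by_cases hk : k < n
    · rw [Bseq_succ R hk]
      exact topOn_nonempty _ ih
    · simpa [Bseq, hk] using ih

theorem mem_Bseq_of_rel (R : Profile (Fin n) A) {x y : A} {k : ℕ} (hk : k ≤ n)
    (hx : x ∈ Bseq R k) (h : ∀ i : Fin n, i < k → (R i).rel y x) : y ∈ Bseq R k := by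
  induction k with
  | zero => trivial
  | succ k ih =>
    rw [Bseq_succ R hk] at hx ⊢
    exact ⟨ih (by omega) hx.1 fun i hi => h i (by omega),
      fun w hw => (R _).trans _ _ _ (h ⟨k, hk⟩ (Nat.lt_succ_self k)) (hx.2 w hw)⟩

theorem mem_Bseq_iff (R : Profile (Fin n) A) {x : A} {k : ℕ} (hk : k ≤ n) :
    x ∈ Bseq R k ↔
      ∀ (y : A) (i : Fin n), i < k → (R i).strict y x → ∃ j < i, (R j).strict x y := by
  induction k with
  | zero => simp [Bseq]
  | succ k ih =>
    rw [Bseq_succ R hk]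
    constructor
    · rintro ⟨hx, htop⟩ y i hi hs
      rcases Nat.lt_succ_iff_lt_or_eq.mp hi with hi | rfl
      · exact (ih (by omega)).mp hx y i hi hs
      · by_contra! hc
        exact hs.2 (htop y (mem_Bseq_of_rel R (by omega) hx
          fun j hj => WeakOrd.rel_of_not_strict (hc j hj)))
    · intro h
      have hx : x ∈ Bseq R k := (ih (by omega)).mpr fun y i hi => h y i (by omega)
      refine ⟨hx, fun y hy => WeakOrd.rel_of_not_strict fun hs => ?_⟩
      obtain ⟨j, hj, hjs⟩ := h y _ (Nat.lt_succ_self k) hs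
      have hjk : (j : ℕ) < k := hj
      have hy' := Bseq_antitone R hjk hy
      rw [Nat.succ_eq_add_one, Bseq_succ R j.isLt] at hy'
      exact hjs.2 (hy'.2 x (Bseq_antitone R hjk.le hx))

theorem mem_C2_iff (R : Profile (Fin n) A) (x : A) : x ∈ C2 R ↔ ∀ y, LexPref R x y := by
  simp [C2, mem_Bseq_iff R le_rfl, LexPref]

theorem mem_C2_topShift_iff (R : Profile (Fin n) A) (x y : A) :
    x ∈ C2 (R.topShift x y) ↔ LexPref R x y := by
  rw [mem_C2_iff]
  have hy : LexPref (R.topShift x y) x y ↔ LexPref R x y := by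
    simp only [LexPref, Profile.topShift, WeakOrd.topShift_strict_iff,
      WeakOrd.topShift_strict_iff']
  refine ⟨fun h => hy.mp (h y), fun h z => ?_⟩
  by_cases hzx : z = x
  · exact hzx ▸ LexPref.refl _ _
  by_cases hzy : z = y
  · exact hzy ▸ hy.mpr h
  · exact fun i hi => absurd hi ((R i).topShift_strict_of_ne hzx hzy).asymm

theorem Profile.topShift_comm (R : Profile (Fin n) A) (x y : A) :
    R.topShift x y = R.topShift y x :=
  funext fun i => (R i).topShift_comm x y

theorem right_mem_C2_topShift_iff (R : Profile (Fin n) A) (x y : A) :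
    y ∈ C2 (R.topShift x y) ↔ LexPref R y x := by
  rw [R.topShift_comm, mem_C2_topShift_iff]

theorem notMem_C2_of_strict_zero (hn : 0 < n) (R : Profile (Fin n) A) {x z : A}
    (h : (R ⟨0, hn⟩).strict x z) : z ∉ C2 R := by
  intro hz
  obtain ⟨j, hj, -⟩ := (mem_C2_iff R z).mp hz x _ h
  exact Nat.not_lt_zero _ hj

theorem niceSet_C2 (R : Profile (Fin n) A) : niceSet C2 R = C2 R := by
  ext x
  rw [mem_C2_iff]
  refine ⟨fun h y => ?_, fun h y _ => (mem_C2_topShift_iff R x y).mpr (h y)⟩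
  by_cases hy : y = x
  · exact hy ▸ LexPref.refl R y
  · exact (mem_C2_topShift_iff R x y).mp (h y hy)

theorem C2_map (σ : Equiv.Perm A) (R : Profile (Fin n) A) :
    C2 (Profile.map σ R) = σ '' C2 R := by
  ext x
  rw [Equiv.image_eq_preimage_symm, Set.mem_preimage, mem_C2_iff, mem_C2_iff]
  exact σ.symm.forall_congr fun _ => Iff.rfl

theorem topMonotonicity_C2 (hn : 0 < n) : TopMonotonicity (C2 (n := n) (A := A)) := by
  rintro R Q x y z - hzx hx ⟨himp, i, hi, hi'⟩
  rw [mem_C2_topShift_iff] at hx ⊢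
  have key : ∀ k, (Q k).strict y x → ∃ j < k, (R j).strict x y := fun k hk => by
    by_cases hR : (R k).strict y x
    · exact hx k hR
    · have hxy := WeakOrd.rel_of_not_strict hR
      by_cases hyx : (R k).rel y x
      · exact absurd ((himp k y).2 ⟨hxy, hyx⟩) hk.2
      · exact absurd hk ((himp k y).1 ⟨hxy, hyx⟩).asymm
  have hQ : LexPref Q x y := fun k hk => by
    obtain ⟨j, hj, hs⟩ := key k hk
    exact ⟨j, hj, (himp j y).1 hs⟩
  refine ⟨hQ, ?_⟩
  by_cases hzy : z = y
  · subst hzy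
    rw [right_mem_C2_topShift_iff]
    intro hz
    have descend : ∀ k, ¬ (Q k).strict x z := by
      intro k
      induction k using WellFoundedLT.induction with
      | ind k ih =>
        intro hk
        obtain ⟨j, hj, hjs⟩ := hz k hk
        obtain ⟨l, hl, hls⟩ := hQ j hjs
        exact ih l (hl.trans hj) hls
    exact descend i hi'
  · exact notMem_C2_of_strict_zero hn _ ((Q _).topShift_strict_of_ne hzx hzy)

theorem not_condorcetConsistent_C2 [Nontrivial A] (hn : 2 ≤ n) :
    ¬ CondorcetConsistent (C2 (n := n) (A := A)) := by
  classical
  intro hC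
  obtain ⟨a, b, hab⟩ := exists_pair_ne A
  let first : Fin n := ⟨0, by omega⟩
  let second : Fin n := ⟨1, by omega⟩
  have hne : second ≠ first := by simp [first, second]
  let u (p q : A) : A → ℕ := fun c => if c = p then 2 else if c = q then 1 else 0
  let R : Profile (Fin n) A := fun i =>
    if i = first then .ofUtility (u a b) else
      if i = second then .ofUtility (u b a) else .ofUtility 0
  have hfirst : (R first).strict a b := by
    simp [R, u, WeakOrd.ofUtility_strict, hab.symm]
  have honly : ∀ y i, y ≠ b → (R i).strict y b → i = first ∧ (R second).strict b y := by
    intro y i hy hs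
    have hi : i = first := by
      by_contra hi
      by_cases hi' : i = second
      · simp only [R, hi', hne, if_true, if_false, WeakOrd.ofUtility_strict, u] at hs
        grind
      · simp [R, hi, hi', WeakOrd.ofUtility_strict] at hs
    refine ⟨hi, ?_⟩
    simp only [R, hne, if_true, if_false, WeakOrd.ofUtility_strict, u]
    grind
  have hb : b ∈ CW R := fun y hy => by
    refine Nat.card_le_card_of_injective
      (fun i : {i // (R i).strict y b} => ⟨second, (honly y i hy i.2).2⟩) ?_
    exact fun i j _ => Subtype.ext ((honly y i hy i.2).1.trans (honly y j hy j.2).1.symm)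
  exact notMem_C2_of_strict_zero (by omega) R hfirst (hC R ⟨b, hb⟩ ▸ hb)

end SerialDictatorship

/-- TA cannot be dropped: the serial dictatorship `C₂` is an SDR
satisfying TC, TN, TM and TR but it is not Condorcet-consistent. -/
theorem stmt_9 {A : Type*} [Fintype A] (hA : 3 ≤ Fintype.card A)
    {n : ℕ} (hn : 2 ≤ n) :
    (∀ R : Profile (Fin n) A, (C2 R).Nonempty) ∧
    TopConsistency (C2 (n := n) (A := A)) ∧
    TopNeutrality (C2 (n := n) (A := A)) ∧
    TopMonotonicity (C2 (n := n) (A := A)) ∧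
    TopRationality (C2 (n := n) (A := A)) ∧
    ¬ CondorcetConsistent (C2 (n := n) (A := A)) := by
  have : Nontrivial A := Fintype.one_lt_card_iff_nontrivial.mp (by omega)
  refine ⟨fun R => Bseq_nonempty R n, fun R _ => (niceSet_C2 R).symm, fun R _ σ => C2_map σ R,
    topMonotonicity_C2 (by omega), fun R x y _ => ?_, not_condorcetConsistent_C2 hn⟩
  rcases LexPref.total R x y with h | h
  · exact ⟨x, (mem_C2_topShift_iff R x y).mpr h, Or.inl rfl⟩
  · exact ⟨y, (right_mem_C2_topShift_iff R x y).mpr h, Or.inr rfl⟩
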